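/- Let u be an arbitrary word and v, w nonempty words over V. Then u ↙ (vw) = Σ_{u=u¹u²} (u¹ ≺ v)(u² ↘ w), where vw and the juxtaposition on the right denote concatenation and the sum runs over all cuts of u (with the empty-word conventions for the quadri-algebra operations). -/

import Mathlib

open Finset MonoidAlgebra TensorProduct

/-- `Sh(p,q)`: permutations of the `p+q` indices that are increasing on the
first `p` indices and on the last `q` indices. -/
def IsSh (p q : ℕ) (σ : Equiv.Perm (Fin (p + q))) : Prop :=
  (∀ i j : Fin (p + q), (i : ℕ) < (j : ℕ) → (j : ℕ) < p → σ i < σ j) ∧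
  (∀ i j : Fin (p + q), p ≤ (i : ℕ) → (i : ℕ) < (j : ℕ) → σ i < σ j)

instance IsSh.decPred (p q : ℕ) : DecidablePred (IsSh p q) := fun _ => by
  unfold IsSh; infer_instance

/-- The word `u_{σ⁻¹(1)} u_{σ⁻¹(2)} ⋯ u_{σ⁻¹(p+q)}` where `u₁ ⋯ u_p` is `u` and
`u_{p+1} ⋯ u_{p+q}` is `v`. -/
def shWord {V : Type*} (u v : List V) (σ : Equiv.Perm (Fin (u.length + v.length))) :
    FreeMonoid V :=
  FreeMonoid.ofList
    (List.ofFn fun i => (u ++ v).get (Fin.cast (List.length_append (as := u) (bs := v)).symm (σ.symm i)))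

/-- `posCond p b i` says that the letter at (combined) index `i` comes from the second
word (`b = true`, i.e. `p ≤ i`) or from the first word (`b = false`, i.e. `i < p`). -/
def posCond (p : ℕ) (b : Bool) (i : ℕ) : Prop :=
  match b with
  | true => p ≤ i
  | false => i < p

instance posCond.dec (p : ℕ) (b : Bool) (i : ℕ) : Decidable (posCond p b i) := by
  cases b <;> unfold posCond <;> infer_instance

variable (k : Type*) [CommRing k] {V : Type*}

/-- The shuffle product `u ⧢ v` of two words, as an element of the monoid algebra
`H` of the free monoid on `V` (sum over all `(p,q)`-shuffles); in particular
`1 ⧢ a = a ⧢ 1 = a`. -/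
noncomputable def shuffleProd (u v : List V) : MonoidAlgebra k (FreeMonoid V) :=
  ∑ σ ∈ univ.filter (IsSh u.length v.length),
    MonoidAlgebra.single (shWord u v σ) (1 : k)

/-- Generic quadri-algebra operation on words: the part of the shuffle product `u ⧢ v`
consisting of the shuffles where the first (resp. last) letter comes from `v` iff `fb`
(resp. `lb`) is `true`.  (For a shuffle permutation, the first letter comes from `v`
iff `σ⁻¹(1) = p+1`, and from `u` iff `σ⁻¹(1) = 1`; the last letter comes from `v` iff
`σ⁻¹(p+q) = p+q`, and from `u` iff `σ⁻¹(p+q) = p`.)  This definition also encodes the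
empty-word conventions: `1 ↘ a = a` and `a ↖ 1 = a` for nonempty `a`, and all other
quadri-algebra operations with an empty argument are `0`. -/
noncomputable def quadOp (fb lb : Bool) (u v : List V) : MonoidAlgebra k (FreeMonoid V) :=
  ∑ σ ∈ univ.filter (fun σ : Equiv.Perm (Fin (u.length + v.length)) =>
      IsSh u.length v.length σ ∧
      ∃ h : 0 < u.length + v.length,
        posCond u.length fb (σ.symm ⟨0, h⟩) ∧
        posCond u.length lb (σ.symm ⟨u.length + v.length - 1, Nat.sub_lt h Nat.one_pos⟩)),
    MonoidAlgebra.single (shWord u v σ) (1 : k)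

/-- `u ↘ v` : shuffles whose first and last letters come from `v`. -/
noncomputable def seOp (u v : List V) : MonoidAlgebra k (FreeMonoid V) := quadOp k true true u v

/-- `u ↗ v` : shuffles whose first letter comes from `v` and last letter from `u`. -/
noncomputable def neOp (u v : List V) : MonoidAlgebra k (FreeMonoid V) := quadOp k true false u v

/-- `u ↖ v` : shuffles whose first and last letters come from `u`. -/
noncomputable def nwOp (u v : List V) : MonoidAlgebra k (FreeMonoid V) := quadOp k false false u v

/-- `u ↙ v` : shuffles whose first letter comes from `u` and last letter from `v`. -/
noncomputable def swOp (u v : List V) : MonoidAlgebra k (FreeMonoid V) := quadOp k false true u v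

/-- `u ≻ v := u ↗ v + u ↘ v`. -/
noncomputable def succOp (u v : List V) : MonoidAlgebra k (FreeMonoid V) := neOp k u v + seOp k u v

/-- `u ≺ v := u ↖ v + u ↙ v`. -/
noncomputable def precOp (u v : List V) : MonoidAlgebra k (FreeMonoid V) := nwOp k u v + swOp k u v

/-- `u ∨ v := u ↘ v + u ↙ v`. -/
noncomputable def veeOp (u v : List V) : MonoidAlgebra k (FreeMonoid V) := seOp k u v + swOp k u v

/-- `u ∧ v := u ↗ v + u ↖ v`. -/
noncomputable def wedgeOp (u v : List V) : MonoidAlgebra k (FreeMonoid V) := neOp k u v + nwOp k u v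

/-- Merge two words along a word of bits. -/
def mrg {V : Type*} : List V → List V → List Bool → List V
  | _, _, [] => []
  | a :: u, v, false :: b => a :: mrg u v b
  | [], _, false :: _ => []
  | u, a :: v, true :: b => a :: mrg u v b
  | _, [], true :: _ => []

/-- Bit words with `p` times `false` and `q` times `true`. -/
def bitW (p q : ℕ) : Finset (List Bool) :=
  ((univ : Finset (Fin (p + q) → Bool)).image List.ofFn).filter
    (fun b => b.count false = p ∧ b.count true = q)

theorem len_eq (b : List Bool) : b.length = b.count false + b.count true := by
  induction b with
  | nil => rfl
  | cons a b ih => cases a <;> simp only [List.length_cons, List.count_cons] <;> simp <;> omega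

theorem mem_bitW (p q : ℕ) (b : List Bool) :
    b ∈ bitW p q ↔ b.count false = p ∧ b.count true = q := by
  unfold bitW
  simp only [mem_filter, mem_image, mem_univ, true_and, and_iff_right_iff_imp]
  rintro ⟨h1, h2⟩
  have h := len_eq b
  rw [h1, h2] at h
  exact ⟨fun i => b[i.val]'(by omega), by
    apply List.ext_getElem <;> simp [h]⟩

theorem mrg_append {V : Type*} (b1 b2 : List Bool) (u1 u2 v1 v2 : List V)
    (h1 : b1.count false = u1.length) (h2 : b1.count true = v1.length) :
    mrg (u1 ++ u2) (v1 ++ v2) (b1 ++ b2) = mrg u1 v1 b1 ++ mrg u2 v2 b2 := by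
  induction b1 generalizing u1 v1 with
  | nil =>
    have e1 : u1 = [] := by simpa using h1.symm
    have e2 : v1 = [] := by simpa using h2.symm
    subst e1 e2
    simp [mrg]
  | cons a b ih =>
    cases a
    · cases u1 with
      | nil => simp at h1
      | cons x u => simp [mrg] at *; exact ih _ _ h1 h2
    · cases v1 with
      | nil => simp at h2
      | cons x v => simp [mrg] at *; exact ih _ _ h1 h2

theorem mrg_get {V : Type*} (b : List Bool) (u v : List V)
    (h1 : b.count false = u.length) (h2 : b.count true = v.length) (i : ℕ) (hi : i < b.length) :
    (mrg u v b)[i]? = if b[i]? = some false then u[(b.take i).count false]?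
      else v[(b.take i).count true]? := by
  induction b generalizing u v i with
  | nil => simp at hi
  | cons a b ih =>
    cases a
    · cases u with
      | nil => simp at h1
      | cons x u =>
        cases i with
        | zero => simp [mrg]
        | succ i =>
          simp [mrg] at *
          rw [ih u v h1 h2 i hi]
    · cases v with
      | nil => simp at h2
      | cons x v =>
        cases i with
        | zero => simp [mrg]
        | succ i =>
          simp [mrg] at *
          rw [ih u v h1 h2 i hi]

theorem mrg_len {V : Type*} (b : List Bool) (u v : List V)
    (h1 : b.count false = u.length) (h2 : b.count true = v.length) :
    (mrg u v b).length = b.length := by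
  induction b generalizing u v with
  | nil => simp [mrg]
  | cons a b ih =>
    cases a
    · cases u with
      | nil => simp at h1
      | cons x u => simp [mrg] at *; exact ih _ _ h1 h2
    · cases v with
      | nil => simp at h2
      | cons x v => simp [mrg] at *; exact ih _ _ h1 h2

theorem count_take_ofFn {n : ℕ} (f : Fin n → Bool) (c : Bool) (i : ℕ) (hi : i ≤ n) :
    ((List.ofFn f).take i).count c = #{j : Fin n | j.val < i ∧ f j = c} := by
  induction i with
  | zero => simp
  | succ i ih =>
    have hl : i < (List.ofFn f).length := by simp; omega
    rw [List.take_succ_eq_append_getElem hl, List.count_append, ih (by omega)]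
    have e : (univ.filter fun j : Fin n => j.val < i + 1 ∧ f j = c)
        = (univ.filter fun j : Fin n => j.val < i ∧ f j = c) ∪
          (univ.filter fun j : Fin n => j = ⟨i, by omega⟩ ∧ f j = c) := by
      ext j
      simp only [mem_filter, mem_univ, true_and, mem_union, Fin.ext_iff]
      have : j.val < i + 1 ↔ j.val < i ∨ j.val = i := by omega
      rw [this]; tauto
    rw [e, card_union_of_disjoint]
    · congr 1
      simp only [List.getElem_ofFn]
      by_cases h : f ⟨i, by omega⟩ = c
      · have : (univ.filter fun j : Fin n => j = ⟨i, by omega⟩ ∧ f j = c) = {⟨i, by omega⟩} := by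
          ext j; simp; rintro rfl; exact h
        rw [this]; simp [h]
      · have : (univ.filter fun j : Fin n => j = ⟨i, by omega⟩ ∧ f j = c) = ∅ := by
          ext j; simp; rintro rfl; exact h
        rw [this]; simp [h]
    · rw [Finset.disjoint_left]
      intro j; simp only [mem_filter, mem_univ, true_and, Fin.ext_iff]; omega

/-- The bit word of a permutation. -/
def bits (p q : ℕ) (σ : Equiv.Perm (Fin (p + q))) : List Bool :=
  List.ofFn fun i => decide (p ≤ (σ.symm i : ℕ))

/-- The inverse shuffle attached to a bit word. -/
def inv (p : ℕ) (b : List Bool) (i : ℕ) : ℕ :=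
  if b[i]? = some false then (b.take i).count false else p + (b.take i).count true

theorem sh_formula (p q : ℕ) (σ : Equiv.Perm (Fin (p + q))) (hσ : IsSh p q σ)
    (i : Fin (p + q)) : (σ.symm i : ℕ) = inv p (bits p q σ) i := by
  unfold inv bits
  obtain ⟨m, rfl⟩ := σ.surjective i
  rw [count_take_ofFn _ _ _ (by omega), count_take_ofFn _ _ _ (by omega)]
  simp only [Equiv.symm_apply_apply, List.getElem?_ofFn, Fin.is_lt, dite_true, Fin.eta,
    Option.some.injEq, decide_eq_false_iff_not, decide_eq_true_iff, not_le]
  split_ifs with h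
  · have e : (univ.filter fun j : Fin (p + q) => j.val < (σ m).val ∧ (σ.symm j).val < p)
        = (Finset.Iio m).map σ.toEmbedding := by
      ext j
      obtain ⟨l, rfl⟩ := σ.surjective j
      simp only [mem_filter, mem_univ, true_and, mem_map_equiv, Equiv.symm_apply_apply,
        Finset.mem_Iio]
      constructor
      · rintro ⟨h1, h2⟩
        by_contra h3
        rcases eq_or_lt_of_le (not_lt.1 h3) with h4 | h4
        · subst h4; omega
        · have := hσ.1 m l h4 h2
          rw [Fin.lt_def] at this; omega
      · intro h1
        exact ⟨hσ.1 l m h1 h, by rw [Fin.lt_def] at h1; omega⟩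
    rw [e]; simp
  · have e : (univ.filter fun j : Fin (p + q) => j.val < (σ m).val ∧ p ≤ (σ.symm j).val)
        = (Finset.Ico ⟨p, by omega⟩ m).map σ.toEmbedding := by
      ext j
      obtain ⟨l, rfl⟩ := σ.surjective j
      simp only [mem_filter, mem_univ, true_and, mem_map_equiv, Equiv.symm_apply_apply,
        Finset.mem_Ico]
      constructor
      · rintro ⟨h1, h2⟩
        refine ⟨h2, ?_⟩
        by_contra h3
        rcases eq_or_lt_of_le (not_lt.1 h3) with h4 | h4
        · subst h4; omega
        · have := hσ.2 m l (by omega) h4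
          rw [Fin.lt_def] at this; omega
      · rintro ⟨h0, h1⟩
        exact ⟨hσ.2 l m h0 h1, h0⟩
    rw [e]; simp; omega

theorem bits_len (p q : ℕ) (σ : Equiv.Perm (Fin (p + q))) : (bits p q σ).length = p + q := by
  simp [bits]

theorem bits_count (p q : ℕ) (σ : Equiv.Perm (Fin (p + q))) :
    (bits p q σ).count false = p ∧ (bits p q σ).count true = q := by
  have h1 : (bits p q σ).count false = p := by
    have h := count_take_ofFn (fun i => decide (p ≤ (σ.symm i : ℕ))) false (p + q) le_rfl
    rw [List.take_of_length_le (by simp)] at h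
    unfold bits
    rw [h]
    have e : (univ.filter fun j : Fin (p + q) => j.val < p + q ∧ decide (p ≤ (σ.symm j).val) = false)
        = ((univ : Finset (Fin p)).map (Fin.castAddEmb q)).map σ.toEmbedding := by
      ext j
      obtain ⟨l, rfl⟩ := σ.surjective j
      simp only [mem_filter, mem_univ, true_and, Equiv.symm_apply_apply, Fin.is_lt,
        decide_eq_false_iff_not, not_le, mem_map]
      constructor
      · intro h
        exact ⟨l, ⟨⟨l, h⟩, by ext; simp⟩, rfl⟩
      · rintro ⟨a, ⟨c, rfl⟩, h⟩
        have h' := σ.injective h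
        rw [← h']; simp
    rw [e]; simp
  have h2 := len_eq (bits p q σ)
  rw [bits_len] at h2
  exact ⟨h1, by omega⟩

theorem count_take_lt (b : List Bool) (c : Bool) (i j : ℕ) (hi : b[i]? = some c) (hij : i < j) :
    (b.take i).count c < (b.take j).count c := by
  obtain ⟨hl, hc⟩ := List.getElem?_eq_some_iff.1 hi
  have h1 : (b.take (i+1)).count c = (b.take i).count c + 1 := by
    rw [List.take_succ_eq_append_getElem hl, List.count_append, hc]; simp
  have h2 : (b.take (i+1)).count c ≤ (b.take j).count c :=
    ((List.take_prefix_take_left (by omega)).sublist).count_le c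
  omega

theorem count_take_lt' (b : List Bool) (c : Bool) (i : ℕ) (hi : b[i]? = some c) :
    (b.take i).count c < b.count c := by
  obtain ⟨hl, hc⟩ := List.getElem?_eq_some_iff.1 hi
  simpa using count_take_lt b c i b.length hi hl

theorem get_cases (b : List Bool) (i : ℕ) (hi : i < b.length) :
    b[i]? = some false ∨ b[i]? = some true := by
  rw [List.getElem?_eq_getElem hi]
  rcases Bool.eq_false_or_eq_true (List.get b ⟨i, hi⟩) with h | h
  · right; exact congrArg some h
  · left; exact congrArg some h

theorem inv_false (p : ℕ) (b : List Bool) (i : ℕ) (h : b[i]? = some false) :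
    inv p b i = (b.take i).count false := by simp [inv, h]

theorem inv_true (p : ℕ) (b : List Bool) (i : ℕ) (h : b[i]? = some true) :
    inv p b i = p + (b.take i).count true := by simp [inv, h]

theorem bits_surj (p q : ℕ) (b : List Bool) (h1 : b.count false = p) (h2 : b.count true = q) :
    ∃ σ : Equiv.Perm (Fin (p + q)), IsSh p q σ ∧ bits p q σ = b := by
  have hl : b.length = p + q := by rw [len_eq, h1, h2]
  have hc : ∀ i : Fin (p + q), (b[i.val]? = some false ∧ inv p b i < p ∧
      inv p b i = (b.take i).count false) ∨
      (b[i.val]? = some true ∧ p ≤ inv p b i ∧ inv p b i < p + q ∧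
      inv p b i = p + (b.take i).count true) := by
    intro i
    rcases get_cases b i (by omega) with h | h
    · left
      have := count_take_lt' b _ _ h
      have := inv_false p b _ h
      exact ⟨h, by omega, this⟩
    · right
      have := count_take_lt' b _ _ h
      have := inv_true p b _ h
      exact ⟨h, by omega, by omega, this⟩
  let f : Fin (p + q) → Fin (p + q) := fun i => ⟨inv p b i, by have := hc i; omega⟩
  have hne : ∀ i j : Fin (p + q), i < j → inv p b i ≠ inv p b j := by
    intro i j hij
    rcases hc i with ⟨hi, hi', hi''⟩ | ⟨hi, hi', hi'', hi'''⟩ <;>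
    rcases hc j with ⟨hj, hj', hj''⟩ | ⟨hj, hj', hj'', hj'''⟩ <;> try omega
    · have := count_take_lt b _ _ _ hi hij; omega
    · have := count_take_lt b _ _ _ hi hij; omega
  have hf : Function.Injective f := by
    intro i j hij
    have hij' : inv p b i = inv p b j := congrArg Fin.val hij
    rcases lt_trichotomy i j with h | h | h
    · exact absurd hij' (hne _ _ h)
    · exact h
    · exact absurd hij'.symm (hne _ _ h)
  let e := Equiv.ofBijective f (Finite.injective_iff_bijective.1 hf)
  have he : ∀ x, (e x : ℕ) = inv p b x := fun x => rfl
  refine ⟨e.symm, ⟨?_, ?_⟩, ?_⟩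
  · intro i j
    obtain ⟨x, rfl⟩ := e.surjective i
    obtain ⟨y, rfl⟩ := e.surjective j
    simp only [Equiv.symm_apply_apply, he]
    intro h3 h4
    by_contra h5
    rcases eq_or_lt_of_le (not_lt.1 h5) with h6 | h6
    · subst h6; omega
    rcases hc x with ⟨hi, hi', hi''⟩ | ⟨hi, hi', hi'', hi'''⟩ <;>
    rcases hc y with ⟨hj, hj', hj''⟩ | ⟨hj, hj', hj'', hj'''⟩ <;> try omega
    have := count_take_lt b _ _ _ hj h6; omega
  · intro i j
    obtain ⟨x, rfl⟩ := e.surjective i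
    obtain ⟨y, rfl⟩ := e.surjective j
    simp only [Equiv.symm_apply_apply, he]
    intro h3 h4
    by_contra h5
    rcases eq_or_lt_of_le (not_lt.1 h5) with h6 | h6
    · subst h6; omega
    rcases hc x with ⟨hi, hi', hi''⟩ | ⟨hi, hi', hi'', hi'''⟩ <;>
    rcases hc y with ⟨hj, hj', hj''⟩ | ⟨hj, hj', hj'', hj'''⟩ <;> try omega
    have := count_take_lt b _ _ _ hj h6; omega
  · apply List.ext_getElem
    · simp [bits_len, hl]
    · intro i h3 h4
      simp only [bits, List.getElem_ofFn, Equiv.symm_symm, he]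
      rcases hc ⟨i, by omega⟩ with ⟨hi, hi', hi''⟩ | ⟨hi, hi', hi'', hi'''⟩
      · rw [List.getElem?_eq_getElem h4, Option.some_inj] at hi
        rw [hi]; simpa using hi'
      · rw [List.getElem?_eq_getElem h4, Option.some_inj] at hi
        rw [hi]; simpa using hi'

theorem shWord_eq {V : Type*} (u v : List V) (σ : Equiv.Perm (Fin (u.length + v.length)))
    (hσ : IsSh u.length v.length σ) :
    shWord u v σ = FreeMonoid.ofList (mrg u v (bits u.length v.length σ)) := by
  unfold shWord
  congr 1
  obtain ⟨h1, h2⟩ := bits_count _ _ σ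
  have hl := bits_len _ _ σ
  apply List.ext_getElem?
  intro i
  by_cases hi : i < u.length + v.length
  · rw [mrg_get _ _ _ h1 h2 i (by omega)]
    have hf := sh_formula _ _ σ hσ ⟨i, hi⟩
    simp only [List.getElem?_ofFn, hi, dite_true, List.get_eq_getElem, Fin.val_cast]
    rw [← List.getElem?_eq_getElem, hf]
    rcases get_cases (bits _ _ σ) i (by omega) with h | h
    · rw [inv_false _ _ _ h, if_pos h, List.getElem?_append_left]
      have := count_take_lt' _ _ _ h; omega
    · rw [inv_true _ _ _ h, if_neg (by simp [h]), List.getElem?_append_right (by omega)]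
      simp
  · rw [List.getElem?_eq_none (by simp; omega), List.getElem?_eq_none]
    rw [mrg_len _ _ _ h1 h2]; omega

theorem posCond_iff (p : ℕ) (c : Bool) (i : ℕ) : posCond p c i ↔ decide (p ≤ i) = c := by
  cases c <;> simp [posCond]

theorem bits_cond (p q : ℕ) (σ : Equiv.Perm (Fin (p + q))) (fb lb : Bool) :
    (∃ h : 0 < p + q, posCond p fb (σ.symm ⟨0, h⟩) ∧
        posCond p lb (σ.symm ⟨p + q - 1, Nat.sub_lt h Nat.one_pos⟩)) ↔
    (bits p q σ).head? = some fb ∧ (bits p q σ).getLast? = some lb := by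
  rw [List.head?_eq_getElem?, List.getLast?_eq_getElem?, bits_len]
  simp only [posCond_iff, bits, List.getElem?_ofFn]
  by_cases h : 0 < p + q
  · have h' : p + q - 1 < p + q := by omega
    simp only [h, h', dite_true, exists_true_left, Option.some_inj]
  · simp [h]

theorem quadOp_eq (fb lb : Bool) (u v : List V) :
    quadOp k fb lb u v = ∑ b ∈ (bitW u.length v.length).filter
      (fun b => b.head? = some fb ∧ b.getLast? = some lb),
      MonoidAlgebra.single (FreeMonoid.ofList (mrg u v b)) (1 : k) := by
  unfold quadOp
  refine Finset.sum_bij (fun σ _ => bits u.length v.length σ) ?_ ?_ ?_ ?_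
  · intro σ hσ
    simp only [mem_filter, mem_univ, true_and] at hσ
    rw [mem_filter, mem_bitW]
    exact ⟨bits_count _ _ σ, (bits_cond _ _ σ fb lb).1 hσ.2⟩
  · intro σ hσ τ hτ h
    simp only [mem_filter, mem_univ, true_and] at hσ hτ
    have : σ.symm = τ.symm := by
      ext i
      rw [sh_formula _ _ σ hσ.1, sh_formula _ _ τ hτ.1, h]
    simpa using congrArg Equiv.symm this
  · intro b hb
    rw [mem_filter, mem_bitW] at hb
    obtain ⟨σ, h1, h2⟩ := bits_surj _ _ b hb.1.1 hb.1.2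
    refine ⟨σ, ?_, h2⟩
    simp only [mem_filter, mem_univ, true_and]
    refine ⟨h1, (bits_cond _ _ σ fb lb).2 ?_⟩
    rw [h2]; exact hb.2
  · intro σ hσ
    simp only [mem_filter, mem_univ, true_and] at hσ
    rw [shWord_eq u v σ hσ.1]

theorem precOp_eq (u v : List V) :
    precOp k u v = ∑ b ∈ (bitW u.length v.length).filter (fun b => b.head? = some false),
      MonoidAlgebra.single (FreeMonoid.ofList (mrg u v b)) (1 : k) := by
  unfold precOp nwOp swOp
  rw [quadOp_eq, quadOp_eq, ← Finset.sum_union]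
  · congr 1
    ext b
    simp only [mem_union, mem_filter]
    constructor
    · tauto
    · rintro ⟨h1, h2⟩
      cases b with
      | nil => simp at h2
      | cons a b =>
        have := List.getLast?_eq_some_getLast (List.cons_ne_nil a b)
        rcases hc : (a :: b).getLast (List.cons_ne_nil a b) with _ | _ <;> rw [hc] at this <;> tauto
  · rw [Finset.disjoint_left]
    intro b
    simp only [mem_filter]
    rintro ⟨_, _, h⟩ ⟨_, _, h'⟩
    rw [h] at h'; simp at h'

theorem split_exists (b : List Bool) (q : ℕ) (h : q < b.count true) :
    ∃ b1 b2, b = b1 ++ true :: b2 ∧ b1.count true = q := by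
  induction b generalizing q with
  | nil => simp at h
  | cons a b ih =>
    cases a
    · obtain ⟨b1, b2, h1, h2⟩ := ih q (by simpa using h)
      exact ⟨false :: b1, b2, by simp [h1], by simpa using h2⟩
    · cases q with
      | zero => exact ⟨[], b, rfl, rfl⟩
      | succ q =>
        obtain ⟨b1, b2, h1, h2⟩ := ih q (by simpa using h)
        exact ⟨true :: b1, b2, by simp [h1], by simpa using h2⟩

theorem split_unique (b1 b2 c1 c2 : List Bool) (h : b1 ++ true :: b2 = c1 ++ true :: c2)
    (hc : b1.count true = c1.count true) : b1 = c1 ∧ b2 = c2 := by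
  induction b1 generalizing c1 with
  | nil =>
    cases c1 with
    | nil => simpa using h
    | cons a c => simp at h; obtain ⟨rfl, _⟩ := h; simp at hc
  | cons x b ih =>
    cases c1 with
    | nil => simp at h; obtain ⟨rfl, _⟩ := h; simp at hc
    | cons a c =>
      simp at h
      obtain ⟨rfl, h⟩ := h
      have := ih c h (by cases x <;> simpa using hc)
      simpa using this

theorem statement5 (u v w : List V) (hv : v ≠ []) (hw : w ≠ []) :
    swOp k u (v ++ w) =
      ∑ i ∈ Finset.range (u.length + 1),
        precOp k (u.take i) v * seOp k (u.drop i) w := by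
  unfold swOp seOp
  simp only [quadOp_eq, precOp_eq, Finset.sum_mul_sum, MonoidAlgebra.single_mul_single, mul_one,
    ← FreeMonoid.ofList_append]
  simp only [← Finset.sum_product']
  rw [Finset.sum_sigma']
  symm
  refine Finset.sum_bij (fun x _ => x.2.1 ++ x.2.2) ?_ ?_ ?_ ?_
  · rintro ⟨i, b1, b2⟩ h
    simp only [mem_sigma, mem_product, mem_filter, mem_bitW, Finset.mem_range, List.length_take,
      List.length_drop, List.length_append, List.count_append] at h ⊢
    obtain ⟨hi, ⟨⟨h1, h2⟩, h3⟩, ⟨h4, h5⟩, h6, h7⟩ := h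
    refine ⟨⟨by omega, by omega⟩, ?_, ?_⟩
    · rw [List.head?_append, h3]; rfl
    · rw [List.getLast?_append, h7]; rfl
  · rintro ⟨i, b1, b2⟩ h ⟨j, c1, c2⟩ h' he
    simp only [mem_sigma, mem_product, mem_filter, mem_bitW, Finset.mem_range, List.length_take,
      List.length_drop] at h h' he
    obtain ⟨hi, ⟨⟨h1, h2⟩, h3⟩, ⟨h4, h5⟩, h6, h7⟩ := h
    obtain ⟨hi', ⟨⟨h1', h2'⟩, h3'⟩, ⟨h4', h5'⟩, h6', h7'⟩ := h'
    obtain ⟨d, rfl⟩ := List.head?_eq_some_iff.1 h6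
    obtain ⟨d', rfl⟩ := List.head?_eq_some_iff.1 h6'
    obtain ⟨rfl, rfl⟩ := split_unique _ _ _ _ he (by omega)
    have : i = j := by omega
    subst this; rfl
  · intro b hb
    simp only [mem_filter, mem_bitW, List.length_append] at hb
    obtain ⟨⟨h1, h2⟩, h3, h4⟩ := hb
    have hwl := List.length_pos_iff.2 hw
    have hvl := List.length_pos_iff.2 hv
    obtain ⟨b1, b2, rfl, h5⟩ := split_exists b v.length (by omega)
    simp only [List.count_append] at h1 h2
    refine ⟨⟨b1.count false, b1, true :: b2⟩, ?_, rfl⟩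
    simp only [mem_sigma, mem_product, mem_filter, mem_bitW, Finset.mem_range, List.length_take,
      List.length_drop]
    refine ⟨by omega, ⟨⟨by omega, h5⟩, ?_⟩, ⟨by omega, by omega⟩, rfl, ?_⟩
    · cases b1 with
      | nil => simp at h5; omega
      | cons a b => simpa using h3
    · rw [List.getLast?_append] at h4
      rw [List.getLast?_eq_some_getLast (List.cons_ne_nil true b2)] at h4 ⊢
      simpa using h4
  · rintro ⟨i, b1, b2⟩ h
    simp only [mem_sigma, mem_product, mem_filter, mem_bitW, Finset.mem_range] at h
    obtain ⟨hi, ⟨⟨h1, h2⟩, h3⟩, ⟨h4, h5⟩, h6, h7⟩ := h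
    simp only
    rw [← mrg_append b1 b2 _ _ _ _ h1 h2, List.take_append_drop]
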